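/- arXiv:1607.07141 — 2 statements merged into one kernel-verified Lean document; each statement's English description precedes it below -/
import Mathlib

section
/- (Example 3.2, L_p Brunn–Minkowski inequality for the width-integral functional.) Let n ≥ 2, r < 1 with r ≠ 0, p ∈ (1,∞), and define F(K) = (∫_{S^{n-1}} w_K(u)^r dH^{n-1}(u))^{1/r}, where w_K(u) = h_K(u) + h_K(-u). Then for all K, L ∈ 𝒦ⁿₒ and all α ∈ (0,1), F((1-α)·_p K +_p α·_p L)^p ≥ (1-α)F(K)^p + αF(L)^p, with equality if and only if K and L are dilates. -/
open scoped Pointwise RealInnerProductSpace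

/-- A convex body in `ℝⁿ`: a compact convex set with nonempty interior. -/
def IsConvexBody {n : ℕ} (K : Set (EuclideanSpace ℝ (Fin n))) : Prop :=
  IsCompact K ∧ Convex ℝ K ∧ (interior K).Nonempty

/-- A convex body containing the origin in its interior. -/
def IsConvexBodyO {n : ℕ} (K : Set (EuclideanSpace ℝ (Fin n))) : Prop :=
  IsCompact K ∧ Convex ℝ K ∧ (0 : EuclideanSpace ℝ (Fin n)) ∈ interior K

/-- The support function of a set: `h_K(u) = sup { ⟪x, u⟫ : x ∈ K }`. -/
noncomputable def supp {n : ℕ} (K : Set (EuclideanSpace ℝ (Fin n)))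
    (u : EuclideanSpace ℝ (Fin n)) : ℝ :=
  sSup ((fun x => ⟪x, u⟫) '' K)

open scoped MeasureTheory

/-- The width function of a set: `w_K(u) = h_K(u) + h_K(-u)`. -/
noncomputable def width {n : ℕ} (K : Set (EuclideanSpace ℝ (Fin n)))
    (u : EuclideanSpace ℝ (Fin n)) : ℝ :=
  supp K u + supp K (-u)

/-- The width-integral functional
`F(K) = (∫_{S^{n-1}} w_K(u)^r dH^{n-1}(u))^{1/r}`. -/
noncomputable def widthFunctional {n : ℕ} (r : ℝ)
    (K : Set (EuclideanSpace ℝ (Fin n))) : ℝ :=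
  (∫ u in Metric.sphere (0 : EuclideanSpace ℝ (Fin n)) 1,
      width K u ^ r ∂μH[(n : ℝ) - 1]) ^ (1 / r)


open MeasureTheory Set Filter Topology

lemma sphere_hausdorff_lt_top (m : ℕ) :
    μH[(m : ℝ)] (Metric.sphere (0 : EuclideanSpace ℝ (Fin (m + 1))) 1) < ⊤ := by
  let face : Fin (m + 1) → ℝ → (Fin m → ℝ) → EuclideanSpace ℝ (Fin (m + 1)) :=
    fun i s y => WithLp.toLp 2 (i.insertNth s y)
  let g : Fin (m + 1) → ℝ → (Fin m → ℝ) → EuclideanSpace ℝ (Fin (m + 1)) :=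
    fun i s y => ‖face i s y‖⁻¹ • face i s y
  let Q : Set (Fin m → ℝ) := Icc (-1) 1
  have hface : ∀ i s, ContDiff ℝ 1 (face i s) := by
    intro i s
    rw [contDiff_euclidean]
    intro j
    refine Fin.succAboveCases i ?_ (fun k => ?_) j
    · simp only [face, Fin.insertNth_apply_same]
      exact contDiff_const
    · simp only [face, Fin.insertNth_apply_succAbove]
      fun_prop
  have hne : ∀ i s y, s ≠ 0 → face i s y ≠ 0 := by
    intro i s y hs h
    apply hs
    have := congrArg (fun v : EuclideanSpace ℝ (Fin (m + 1)) => v i) h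
    simpa [face] using this
  have hg : ∀ i s, s ≠ 0 → ContDiff ℝ 1 (g i s) := by
    intro i s hs
    exact (((hface i s).norm ℝ (fun y => hne i s y hs)).inv
      (fun y => norm_ne_zero_iff.2 (hne i s y hs))).smul (hface i s)
  have hfin : ∀ i s, s ≠ 0 → μH[(m : ℝ)] (g i s '' Q) < ⊤ := by
    intro i s hs
    obtain ⟨C, hC⟩ := (hg i s hs).contDiffOn.exists_lipschitzOnWith (s := Q) one_ne_zero
      (convex_Icc _ _) isCompact_Icc
    refine (hC.hausdorffMeasure_image_le (Nat.cast_nonneg m)).trans_lt ?_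
    have h1 : (μH[(m : ℝ)] : Measure (Fin m → ℝ)) = volume := by
      have := hausdorffMeasure_pi_real (ι := Fin m)
      simpa using this
    rw [h1]
    refine ENNReal.mul_lt_top ?_ isCompact_Icc.measure_lt_top
    rw [ENNReal.rpow_natCast]
    exact ENNReal.pow_lt_top ENNReal.coe_lt_top
  have hcover : Metric.sphere (0 : EuclideanSpace ℝ (Fin (m + 1))) 1 ⊆
      ⋃ i : Fin (m + 1), (g i 1 '' Q ∪ g i (-1) '' Q) := by
    intro u hu
    have hu1 : ‖u‖ = 1 := by simpa using hu
    obtain ⟨i, -, hi⟩ := Finset.exists_max_image Finset.univ (fun j => |u j|)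
      ⟨(0 : Fin (m + 1)), Finset.mem_univ _⟩
    have hpos : 0 < |u i| := by
      by_contra hcon
      have hz : u = 0 := by
        ext j
        have := hi j (Finset.mem_univ _)
        have h0 : |u j| ≤ 0 := by linarith
        simpa using h0
      rw [hz] at hu1
      simp at hu1
    let y : Fin m → ℝ := fun k => u (i.succAbove k) / |u i|
    have hy : y ∈ Q := by
      have : ∀ k, |y k| ≤ 1 := by
        intro k
        simp only [y, abs_div, abs_abs]
        rw [div_le_one hpos]
        exact hi _ (Finset.mem_univ _)
      exact ⟨fun k => (abs_le.1 (this k)).1, fun k => (abs_le.1 (this k)).2⟩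
    have key : ∀ s, s = u i / |u i| → g i s y = u := by
      intro s hs
      have hf : face i s y = |u i|⁻¹ • u := by
        ext j
        refine Fin.succAboveCases i ?_ (fun k => ?_) j
        · simp [face, hs, div_eq_inv_mul]
        · simp [face, y, div_eq_inv_mul]
      simp only [g, hf, norm_smul, hu1, smul_smul]
      simp [hpos.ne']
    refine mem_iUnion.2 ⟨i, ?_⟩
    rcases lt_or_gt_of_ne (abs_pos.1 hpos) with h | h
    · refine Or.inr ⟨y, hy, key _ ?_⟩
      rw [abs_of_neg h, div_neg, div_self h.ne]
    · refine Or.inl ⟨y, hy, key _ ?_⟩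
      rw [abs_of_pos h]; field_simp
  refine (measure_mono hcover).trans_lt ?_
  refine (measure_iUnion_le _).trans_lt ?_
  rw [tsum_fintype]
  refine ENNReal.sum_lt_top.2 fun i _ => ?_
  refine (measure_union_le _ _).trans_lt ?_
  exact ENNReal.add_lt_top.2 ⟨hfin i 1 one_ne_zero, hfin i (-1) (by norm_num)⟩

lemma sphere_hausdorff_open_pos (m : ℕ) (V : Set (EuclideanSpace ℝ (Fin (m + 1))))
    (hV : IsOpen V) (u : EuclideanSpace ℝ (Fin (m + 1))) (huV : u ∈ V) (hu : ‖u‖ = 1) :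
    0 < μH[(m : ℝ)] (V ∩ Metric.sphere 0 1) := by
  obtain ⟨i, hi⟩ : ∃ i, u i ≠ 0 := by
    by_contra! h
    have : u = 0 := by ext j; simpa using h j
    rw [this] at hu; simp at hu
  have hsum : ∀ v : EuclideanSpace ℝ (Fin (m + 1)), ‖v‖ ^ 2 = v i ^ 2 + ∑ k, v (i.succAbove k) ^ 2 := by
    intro v
    rw [EuclideanSpace.norm_sq_eq, Fin.sum_univ_succAbove _ i]
    simp
  let drop : EuclideanSpace ℝ (Fin (m + 1)) → (Fin m → ℝ) := fun v k => v (i.succAbove k)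
  have hdrop : LipschitzWith 1 drop := by
    refine LipschitzWith.of_dist_le_mul fun v w => ?_
    rw [NNReal.coe_one, one_mul, dist_pi_le_iff dist_nonneg]
    intro k
    rw [Real.dist_eq, EuclideanSpace.dist_eq]
    apply Real.le_sqrt_of_sq_le
    rw [← Real.dist_eq]
    exact Finset.single_le_sum (f := fun j => dist (v j) (w j) ^ 2)
      (fun j _ => sq_nonneg _) (Finset.mem_univ (i.succAbove k))
  let ε : ℝ := u i / |u i|
  have hε : ε ^ 2 = 1 := by
    simp only [ε, div_pow, sq_abs]
    field_simp
  let q : (Fin m → ℝ) → ℝ := fun y => 1 - ∑ k, y k ^ 2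
  let g : (Fin m → ℝ) → EuclideanSpace ℝ (Fin (m + 1)) :=
    fun y => WithLp.toLp 2 (i.insertNth (ε * √(q y)) y)
  have hq : Continuous q := by fun_prop
  have hg : Continuous g := by
    refine (PiLp.continuous_toLp 2 _).comp ?_
    refine Continuous.finInsertNth i ?_ continuous_id
    fun_prop
  let W : Set (Fin m → ℝ) := g ⁻¹' V ∩ q ⁻¹' Ioi 0
  have hW : IsOpen W := (hV.preimage hg).inter (isOpen_Ioi.preimage hq)
  have hqu : q (drop u) = u i ^ 2 := by
    have := hsum u
    rw [hu] at this
    simp only [q, drop]; linarith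
  have hgu : g (drop u) = u := by
    ext j
    refine Fin.succAboveCases i ?_ (fun k => ?_) j
    · simp only [g, Fin.insertNth_apply_same, hqu, Real.sqrt_sq_eq_abs, ε]
      field_simp [abs_ne_zero.2 hi]
    · simp [g, drop]
  have hne : W.Nonempty := ⟨drop u, by
    refine ⟨?_, ?_⟩
    · simpa [hgu] using huV
    · simp only [mem_preimage, hqu, mem_Ioi]; positivity⟩
  have hsub : W ⊆ drop '' (V ∩ Metric.sphere 0 1) := by
    rintro y ⟨hy1, hy2⟩
    refine ⟨g y, ⟨hy1, ?_⟩, ?_⟩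
    · have h2 : ‖g y‖ ^ 2 = 1 := by
        rw [hsum]
        simp only [g, Fin.insertNth_apply_same, Fin.insertNth_apply_succAbove, mul_pow, hε]
        rw [Real.sq_sqrt (le_of_lt hy2)]
        simp [q]
      have h3 : ‖g y‖ = 1 := by
        rw [← Real.sqrt_sq (norm_nonneg (g y)), h2, Real.sqrt_one]
      simpa using h3
    · ext k; simp [drop, g]
  have h1 : (μH[(m : ℝ)] : Measure (Fin m → ℝ)) = volume := by
    have := hausdorffMeasure_pi_real (ι := Fin m)
    simpa using this
  have hle := hdrop.hausdorffMeasure_image_le (d := (m : ℝ)) (Nat.cast_nonneg m)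
    (V ∩ Metric.sphere 0 1)
  have : 0 < μH[(m : ℝ)] W := by rw [h1]; exact hW.measure_pos _ hne
  have h4 := this.trans_le ((measure_mono hsub).trans hle)
  simpa using h4

lemma rpow_key {W V t r : ℝ} (hW : 0 < W) (hV : 0 < V) (ht0 : 0 < t) (ht1 : t < 1)
    (hr : r < 1) :
    r * (t * W ^ r + (1 - t) * V ^ r) ≤ r * (t * W + (1 - t) * V) ^ r := by
  rcases lt_or_ge r 0 with h | h
  · apply mul_le_mul_of_nonpos_left _ h.le
    have h1 := Real.geom_mean_le_arith_mean2_weighted ht0.le (sub_pos.2 ht1).le hW.le hV.le (by ring)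
    have h2 := Real.geom_mean_le_arith_mean2_weighted ht0.le (sub_pos.2 ht1).le
      (Real.rpow_pos_of_pos hW r).le (Real.rpow_pos_of_pos hV r).le (by ring)
    refine le_trans (Real.rpow_le_rpow_of_nonpos (by positivity) h1 h.le) (le_trans (le_of_eq ?_) h2)
    rw [Real.mul_rpow (by positivity) (by positivity), ← Real.rpow_mul hW.le, ← Real.rpow_mul hW.le,
      ← Real.rpow_mul hV.le, ← Real.rpow_mul hV.le, mul_comm t, mul_comm (1 - t)]
  · apply mul_le_mul_of_nonneg_left _ h
    have := (Real.concaveOn_rpow h hr.le).2 (mem_Ici.2 hW.le) (mem_Ici.2 hV.le) ht0.le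
      (sub_pos.2 ht1).le (by ring)
    simpa using this

lemma mul_rpow_strict {x y r : ℝ} (hx : 0 < x) (hxy : x < y) (hr0 : r ≠ 0) :
    r * x ^ r < r * y ^ r := by
  rcases lt_or_gt_of_ne hr0 with h | h
  · exact mul_lt_mul_of_neg_left (Real.rpow_lt_rpow_of_neg hx hxy h) h
  · exact mul_lt_mul_of_pos_left (Real.rpow_lt_rpow hx.le hxy h) h

/-- Power mean inequality. -/
lemma pow_mean {a c m t p : ℝ} (ha : 0 < a) (hc : 0 < c) (hm : 0 < m) (ht0 : 0 < t) (ht1 : t < 1)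
    (hp : 1 < p) (h : m ^ p = t * a ^ p + (1 - t) * c ^ p) :
    t * a + (1 - t) * c ≤ m ∧ (t * a + (1 - t) * c = m → a = c) := by
  have hs := sub_pos.2 ht1
  have hlt : a ≠ c → t * a + (1 - t) * c < m := by
    intro hne
    have := (strictConvexOn_rpow hp).2 (mem_Ici.2 ha.le) (mem_Ici.2 hc.le) hne ht0 hs (by ring)
    simp only [smul_eq_mul] at this
    rw [← h] at this
    exact (Real.rpow_lt_rpow_iff (by positivity) hm.le (by linarith)).1 this
  refine ⟨?_, fun he => ?_⟩
  · by_cases hne : a = c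
    · subst hne
      have : m ^ p = a ^ p := by rw [h]; ring
      have : m = a := (Real.rpow_left_inj hm.le ha.le (by linarith)).1 this
      rw [this]; apply le_of_eq; ring
    · exact (hlt hne).le
  · by_contra hne
    exact (hlt hne).ne he

lemma pointwise_key {a b c d m₁ m₂ t p r : ℝ} (ha : 0 < a) (hb : 0 < b) (hc : 0 < c) (hd : 0 < d)
    (h1 : 0 < m₁) (h2 : 0 < m₂) (ht0 : 0 < t) (ht1 : t < 1) (hp : 1 < p) (hr : r < 1) (hr0 : r ≠ 0)
    (e1 : m₁ ^ p = t * a ^ p + (1 - t) * c ^ p) (e2 : m₂ ^ p = t * b ^ p + (1 - t) * d ^ p) :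
    r * (t * (a + b) ^ r + (1 - t) * (c + d) ^ r) ≤ r * (m₁ + m₂) ^ r ∧
    (r * (t * (a + b) ^ r + (1 - t) * (c + d) ^ r) = r * (m₁ + m₂) ^ r → a = c) := by
  have hs := sub_pos.2 ht1
  obtain ⟨l1, q1⟩ := pow_mean ha hc h1 ht0 ht1 hp e1
  obtain ⟨l2, q2⟩ := pow_mean hb hd h2 ht0 ht1 hp e2
  have hk := rpow_key (add_pos ha hb) (add_pos hc hd) ht0 ht1 hr
  have hpos : 0 < t * (a + b) + (1 - t) * (c + d) := by positivity
  have hle : t * (a + b) + (1 - t) * (c + d) ≤ m₁ + m₂ := by linarith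
  rcases hle.eq_or_lt with he | hl
  · refine ⟨?_, fun _ => q1 (by linarith)⟩
    rw [← he]; exact hk
  · have := mul_rpow_strict hpos hl hr0
    exact ⟨hk.trans this.le, fun h => absurd h (hk.trans_lt this).ne⟩

section

variable {n : ℕ}

lemma supp_bdd {K : Set (EuclideanSpace ℝ (Fin n))} (hK : IsCompact K)
    (u : EuclideanSpace ℝ (Fin n)) : BddAbove ((fun x => ⟪x, u⟫) '' K) :=
  (hK.image (by fun_prop)).bddAbove

lemma le_supp {K : Set (EuclideanSpace ℝ (Fin n))} (hK : IsCompact K)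
    {x : EuclideanSpace ℝ (Fin n)} (hx : x ∈ K) (u : EuclideanSpace ℝ (Fin n)) :
    ⟪x, u⟫ ≤ supp K u := le_csSup (supp_bdd hK u) ⟨x, hx, rfl⟩

lemma supp_continuous {K : Set (EuclideanSpace ℝ (Fin n))} (hK : IsCompact K) :
    Continuous (supp K) :=
  hK.continuous_sSup (f := fun u x => ⟪x, u⟫) (by
    change Continuous fun z : EuclideanSpace ℝ (Fin n) × EuclideanSpace ℝ (Fin n) => ⟪z.2, z.1⟫
    fun_prop)

lemma supp_pos {K : Set (EuclideanSpace ℝ (Fin n))} (hK : IsConvexBodyO K)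
    {u : EuclideanSpace ℝ (Fin n)} (hu : ‖u‖ = 1) : 0 < supp K u := by
  obtain ⟨ε, hε, hb⟩ := Metric.isOpen_iff.1 isOpen_interior _ hK.2.2
  have hx : (ε / 2) • u ∈ K := by
    apply interior_subset
    apply hb
    simp only [Metric.mem_ball, dist_zero_right, norm_smul, hu, Real.norm_eq_abs]
    rw [abs_of_pos (by positivity)]; linarith
  refine lt_of_lt_of_le ?_ (le_supp hK.1 hx u)
  rw [real_inner_smul_left, real_inner_self_eq_norm_sq, hu]
  positivity

lemma supp_smul_set (K : Set (EuclideanSpace ℝ (Fin n))) {c : ℝ} (hc : 0 ≤ c)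
    (u : EuclideanSpace ℝ (Fin n)) : supp (c • K) u = c * supp K u := by
  unfold supp
  rw [← smul_eq_mul, ← Real.sSup_smul_of_nonneg hc]
  congr 1
  ext y
  simp only [mem_image, mem_smul_set, exists_exists_and_eq_and, real_inner_smul_left, smul_eq_mul]

lemma supp_smul_vec (K : Set (EuclideanSpace ℝ (Fin n))) {c : ℝ} (hc : 0 ≤ c)
    (u : EuclideanSpace ℝ (Fin n)) : supp K (c • u) = c * supp K u := by
  unfold supp
  rw [← smul_eq_mul, ← Real.sSup_smul_of_nonneg hc]
  congr 1
  ext y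
  simp only [mem_image, mem_smul_set, exists_exists_and_eq_and, real_inner_smul_right, smul_eq_mul]

lemma subset_of_supp_le {K L : Set (EuclideanSpace ℝ (Fin n))} (hK : IsCompact K)
    (hL : IsCompact L) (hLc : Convex ℝ L) (hne : L.Nonempty)
    (h : ∀ u, ‖u‖ = 1 → supp K u ≤ supp L u) : K ⊆ L := by
  intro x hx
  by_contra hxL
  obtain ⟨f, s, hf1, hf2⟩ := geometric_hahn_banach_closed_point hLc hL.isClosed hxL
  let v := (InnerProductSpace.toDual ℝ (EuclideanSpace ℝ (Fin n))).symm f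
  have hv : ∀ y, ⟪y, v⟫ = f y := by
    intro y
    rw [real_inner_comm]
    exact InnerProductSpace.toDual_symm_apply
  have hv0 : v ≠ 0 := by
    intro h0
    obtain ⟨y, hy⟩ := hne
    have h1 := hf1 y hy
    rw [← hv] at h1 hf2
    rw [h0, inner_zero_right] at h1 hf2
    linarith
  have hpos : 0 < ‖v‖ := norm_pos_iff.2 hv0
  have hu := h (‖v‖⁻¹ • v) (by rw [norm_smul, norm_inv, norm_norm]; field_simp)
  rw [supp_smul_vec _ (by positivity), supp_smul_vec _ (by positivity)] at hu
  have hu' := le_of_mul_le_mul_left hu (by positivity)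
  have h1 := le_supp hK hx v
  have h2 : supp L v ≤ s := by
    refine csSup_le (hne.image _) ?_
    rintro _ ⟨y, hy, rfl⟩
    have := hf1 y hy
    simp only [hv]; exact this.le
  rw [hv] at h1
  linarith

/-- The measure on the sphere. -/
noncomputable def sphMeas (n : ℕ) : Measure (EuclideanSpace ℝ (Fin n)) :=
  (μH[(n : ℝ) - 1]).restrict (Metric.sphere (0 : EuclideanSpace ℝ (Fin n)) 1)

lemma sphMeas_finite (hn : 2 ≤ n) : IsFiniteMeasure (sphMeas n) := by
  obtain ⟨m, rfl⟩ : ∃ m, n = m + 1 := ⟨n - 1, by omega⟩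
  constructor
  rw [sphMeas, Measure.restrict_apply_univ]
  have := sphere_hausdorff_lt_top m
  simpa using this

lemma sphMeas_open_pos (hn : 2 ≤ n) {V : Set (EuclideanSpace ℝ (Fin n))} (hV : IsOpen V)
    {u : EuclideanSpace ℝ (Fin n)} (hu : ‖u‖ = 1) (huV : u ∈ V) : 0 < sphMeas n V := by
  obtain ⟨m, rfl⟩ : ∃ m, n = m + 1 := ⟨n - 1, by omega⟩
  rw [sphMeas, Measure.restrict_apply hV.measurableSet]
  have := sphere_hausdorff_open_pos m V hV u huV hu
  simpa using this

lemma sphMeas_ae (n : ℕ) : ∀ᵐ u ∂(sphMeas n), ‖u‖ = 1 := by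
  have := ae_restrict_mem (μ := μH[(n : ℝ) - 1])
    (Metric.isClosed_sphere (x := (0 : EuclideanSpace ℝ (Fin n))) (ε := 1)).measurableSet
  filter_upwards [this] with u hu
  simpa using hu

lemma sphMeas_integrable (hn : 2 ≤ n) {f : EuclideanSpace ℝ (Fin n) → ℝ}
    (hf : ContinuousOn f (Metric.sphere 0 1)) : Integrable f (sphMeas n) := by
  have := sphMeas_finite hn
  have h := hf.integrableOn_compact (μ := sphMeas n) (isCompact_sphere _ _)
  rw [IntegrableOn, sphMeas, Measure.restrict_restrict_of_subset le_rfl] at h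
  exact h

lemma sphMeas_eq (hn : 2 ≤ n) {f g : EuclideanSpace ℝ (Fin n) → ℝ}
    (hf : ContinuousOn f (Metric.sphere 0 1)) (hg : ContinuousOn g (Metric.sphere 0 1))
    (h : f =ᵐ[sphMeas n] g) {u : EuclideanSpace ℝ (Fin n)} (hu : ‖u‖ = 1) : f u = g u := by
  by_contra hne
  obtain ⟨V, hV, hVe⟩ := continuousOn_iff'.1 (hf.sub hg) {0}ᶜ isOpen_compl_singleton
  have huV : u ∈ V := by
    have : u ∈ (f - g) ⁻¹' {0}ᶜ ∩ Metric.sphere 0 1 :=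
      ⟨by simpa [sub_eq_zero] using hne, by simpa using hu⟩
    rw [hVe] at this
    exact this.1
  refine (sphMeas_open_pos hn hV hu huV).ne' ?_
  refine measure_mono_null (t := {x | ¬ (f x = g x ∧ ‖x‖ = 1)} ∪ {x | ¬ ‖x‖ = 1}) ?_ ?_
  · intro x hx
    by_cases hx1 : ‖x‖ = 1
    · left
      have : x ∈ V ∩ Metric.sphere 0 1 := ⟨hx, by simpa using hx1⟩
      rw [← hVe] at this
      have := this.1
      simp only [mem_preimage, mem_compl_iff, mem_singleton_iff, Pi.sub_apply, sub_eq_zero] at this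
      simp [this]
    · exact Or.inr hx1
  · exact measure_union_null (ae_iff.1 (h.and (sphMeas_ae n))) (ae_iff.1 (sphMeas_ae n))

lemma width_pos {K : Set (EuclideanSpace ℝ (Fin n))} (hK : IsConvexBodyO K)
    {u : EuclideanSpace ℝ (Fin n)} (hu : ‖u‖ = 1) : 0 < width K u :=
  add_pos (supp_pos hK hu) (supp_pos hK (by simpa using hu))

lemma width_continuousOn {K : Set (EuclideanSpace ℝ (Fin n))} (hK : IsConvexBodyO K) (r : ℝ) :
    ContinuousOn (fun u => width K u ^ r) (Metric.sphere 0 1) := by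
  have hc : Continuous (width K) :=
    (supp_continuous hK.1).add ((supp_continuous hK.1).comp continuous_neg)
  exact hc.continuousOn.rpow_const fun u hu => Or.inl (width_pos hK (by simpa using hu)).ne'

lemma width_integral_pos (hn : 2 ≤ n) {K : Set (EuclideanSpace ℝ (Fin n))} (hK : IsConvexBodyO K)
    (r : ℝ) : 0 < ∫ u, width K u ^ r ∂(sphMeas n) := by
  have h0 : 0 ≤ᵐ[sphMeas n] fun u => width K u ^ r := by
    filter_upwards [sphMeas_ae n] with u hu
    exact (Real.rpow_pos_of_pos (width_pos hK hu) r).le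
  have hi := sphMeas_integrable hn (width_continuousOn hK r)
  refine lt_of_le_of_ne (integral_nonneg_of_ae h0) fun he => ?_
  have h1 := (integral_eq_zero_iff_of_nonneg_ae h0 hi).1 he.symm
  have : Nonempty (Fin n) := ⟨⟨0, by omega⟩⟩
  obtain ⟨u, hu⟩ := exists_norm_eq (EuclideanSpace ℝ (Fin n)) (zero_le_one (α := ℝ))
  have h2 := sphMeas_eq hn (width_continuousOn hK r) continuousOn_const h1 hu
  exact (Real.rpow_pos_of_pos (width_pos hK hu) r).ne' h2

lemma widthFunctional_pos (hn : 2 ≤ n) {K : Set (EuclideanSpace ℝ (Fin n))} (hK : IsConvexBodyO K)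
    (r : ℝ) : 0 < widthFunctional r K := Real.rpow_pos_of_pos (width_integral_pos hn hK r) _

lemma widthFunctional_rpow (hn : 2 ≤ n) {K : Set (EuclideanSpace ℝ (Fin n))} (hK : IsConvexBodyO K)
    {r : ℝ} (hr0 : r ≠ 0) : widthFunctional r K ^ r = ∫ u, width K u ^ r ∂(sphMeas n) := by
  change ((∫ u, width K u ^ r ∂(sphMeas n)) ^ (1 / r)) ^ r = _
  rw [← Real.rpow_mul (width_integral_pos hn hK r).le, one_div_mul_cancel hr0, Real.rpow_one]

lemma widthFunctional_scale (hn : 2 ≤ n) {K L : Set (EuclideanSpace ℝ (Fin n))}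
    (hL : IsConvexBodyO L) {r c : ℝ} (hr0 : r ≠ 0) (hc : 0 < c)
    (h : ∀ u, ‖u‖ = 1 → supp K u = c * supp L u) :
    widthFunctional r K = c * widthFunctional r L := by
  change (∫ u, width K u ^ r ∂(sphMeas n)) ^ (1 / r) =
    c * (∫ u, width L u ^ r ∂(sphMeas n)) ^ (1 / r)
  have : ∫ u, width K u ^ r ∂(sphMeas n) = c ^ r * ∫ u, width L u ^ r ∂(sphMeas n) := by
    rw [← integral_const_mul]
    refine integral_congr_ae ?_
    filter_upwards [sphMeas_ae n] with u hu
    have : width K u = c * width L u := by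
      rw [width, width, h u hu, h (-u) (by simpa using hu)]; ring
    rw [this, Real.mul_rpow hc.le (width_pos hL hu).le]
  rw [this, Real.mul_rpow (by positivity) (width_integral_pos hn hL r).le, ← Real.rpow_mul hc.le,
    mul_one_div_cancel hr0, Real.rpow_one]

end


/-- Example 3.2, `L_p` Brunn–Minkowski inequality for the
width-integral functional. For `n ≥ 2`, `r < 1`, `r ≠ 0`, `1 < p < ∞`,
`K, L ∈ 𝒦ⁿₒ`, `α ∈ (0,1)`, and `M = (1-α)·_p K +_p α·_p L` (the convex body with
origin in its interior whose support function satisfies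
`h_M^p = (1-α) h_K^p + α h_L^p` on the unit sphere),
`F(M)^p ≥ (1-α)F(K)^p + αF(L)^p`, with equality if and only if `K` and `L` are
dilates. -/
theorem widthFunctional_lp_BrunnMinkowski {n : ℕ} (hn : 2 ≤ n)
    (r : ℝ) (hr : r < 1) (hr0 : r ≠ 0) (p : ℝ) (hp : 1 < p)
    (K L M : Set (EuclideanSpace ℝ (Fin n)))
    (hK : IsConvexBodyO K) (hL : IsConvexBodyO L) (hM : IsConvexBodyO M)
    (α : ℝ) (hα : α ∈ Set.Ioo (0:ℝ) 1)
    (hMsupp : ∀ u : EuclideanSpace ℝ (Fin n), ‖u‖ = 1 →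
      supp M u ^ p = (1 - α) * supp K u ^ p + α * supp L u ^ p) :
    (1 - α) * widthFunctional r K ^ p + α * widthFunctional r L ^ p ≤
        widthFunctional r M ^ p ∧
      (widthFunctional r M ^ p =
          (1 - α) * widthFunctional r K ^ p + α * widthFunctional r L ^ p ↔
        ∃ c : ℝ, 0 < c ∧ K = c • L) := by
  obtain ⟨hα0, hα1⟩ := hα
  have hα1' : 0 < 1 - α := sub_pos.2 hα1
  have hp0 : 0 < p := by linarith
  set A := widthFunctional r K with hA
  set B := widthFunctional r L with hB
  set D := widthFunctional r M with hD
  have A0 : 0 < A := widthFunctional_pos hn hK r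
  have B0 : 0 < B := widthFunctional_pos hn hL r
  have D0 : 0 < D := widthFunctional_pos hn hM r
  have hS : 0 < (1 - α) * A ^ p + α * B ^ p := by positivity
  obtain ⟨C, C0, hC⟩ : ∃ C : ℝ, 0 < C ∧ C ^ p = (1 - α) * A ^ p + α * B ^ p :=
    ⟨((1 - α) * A ^ p + α * B ^ p) ^ p⁻¹, by positivity, Real.rpow_inv_rpow hS.le hp0.ne'⟩
  have Ap : 0 < A ^ p := by positivity
  have Bp : 0 < B ^ p := by positivity
  have Cp : 0 < C ^ p := by positivity
  let t : ℝ := (1 - α) * A ^ p / C ^ p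
  have ht0 : 0 < t := by positivity
  have ht1e : 1 - t = α * B ^ p / C ^ p := by
    simp only [t]; field_simp; linarith
  have ht1 : t < 1 := by
    have : 0 < 1 - t := by rw [ht1e]; positivity
    linarith
  have hsc : ∀ u : EuclideanSpace ℝ (Fin n), ‖u‖ = 1 →
      (supp M u / C) ^ p = t * (supp K u / A) ^ p + (1 - t) * (supp L u / B) ^ p := by
    intro u hu
    rw [ht1e, Real.div_rpow (supp_pos hM hu).le C0.le, Real.div_rpow (supp_pos hK hu).le A0.le,
      Real.div_rpow (supp_pos hL hu).le B0.le, hMsupp u hu]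
    simp only [t]
    field_simp
  have hpt : ∀ u : EuclideanSpace ℝ (Fin n), ‖u‖ = 1 →
      r * (t * (width K u ^ r / A ^ r) + (1 - t) * (width L u ^ r / B ^ r)) ≤
        r * (width M u ^ r / C ^ r) ∧
      (r * (t * (width K u ^ r / A ^ r) + (1 - t) * (width L u ^ r / B ^ r)) =
        r * (width M u ^ r / C ^ r) → supp K u / A = supp L u / B) := by
    intro u hu
    have hu' : ‖-u‖ = 1 := by simpa using hu
    have := pointwise_key (div_pos (supp_pos hK hu) A0) (div_pos (supp_pos hK hu') A0)
      (div_pos (supp_pos hL hu) B0) (div_pos (supp_pos hL hu') B0)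
      (div_pos (supp_pos hM hu) C0) (div_pos (supp_pos hM hu') C0) ht0 ht1 hp hr hr0
      (hsc u hu) (hsc (-u) hu')
    rw [← add_div, ← add_div, ← add_div] at this
    change r * (t * (width K u / A) ^ r + (1 - t) * (width L u / B) ^ r) ≤
        r * (width M u / C) ^ r ∧
      (r * (t * (width K u / A) ^ r + (1 - t) * (width L u / B) ^ r) =
        r * (width M u / C) ^ r → supp K u / A = supp L u / B) at this
    rwa [Real.div_rpow (width_pos hK hu).le A0.le, Real.div_rpow (width_pos hL hu).le B0.le,
      Real.div_rpow (width_pos hM hu).le C0.le] at this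
  have iK := sphMeas_integrable hn (width_continuousOn hK r)
  have iL := sphMeas_integrable hn (width_continuousOn hL r)
  have iM := sphMeas_integrable hn (width_continuousOn hM r)
  have i1 : Integrable (fun u => r * (t * (width K u ^ r / A ^ r) +
      (1 - t) * (width L u ^ r / B ^ r))) (sphMeas n) :=
    (((iK.div_const _).const_mul _).add ((iL.div_const _).const_mul _)).const_mul _
  have i2 : Integrable (fun u => r * (width M u ^ r / C ^ r)) (sphMeas n) :=
    (iM.div_const _).const_mul _
  have hle : (fun u => r * (t * (width K u ^ r / A ^ r) + (1 - t) * (width L u ^ r / B ^ r)))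
      ≤ᵐ[sphMeas n] (fun u => r * (width M u ^ r / C ^ r)) := by
    filter_upwards [sphMeas_ae n] with u hu using (hpt u hu).1
  have e1 : ∫ u, r * (t * (width K u ^ r / A ^ r) + (1 - t) * (width L u ^ r / B ^ r)) ∂(sphMeas n)
      = r := by
    rw [integral_const_mul, integral_add ((iK.div_const _).const_mul _)
      ((iL.div_const _).const_mul _), integral_const_mul, integral_const_mul, integral_div,
      integral_div, ← widthFunctional_rpow hn hK hr0, ← widthFunctional_rpow hn hL hr0,
      div_self (Real.rpow_pos_of_pos A0 r).ne', div_self (Real.rpow_pos_of_pos B0 r).ne']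
    ring
  have e2 : ∫ u, r * (width M u ^ r / C ^ r) ∂(sphMeas n) = r * (D ^ r / C ^ r) := by
    rw [integral_const_mul, integral_div, ← widthFunctional_rpow hn hM hr0]
  have hCD : C ≤ D := by
    by_contra! hlt
    have h1 := integral_mono_ae i1 i2 hle
    rw [e1, e2, ← Real.div_rpow D0.le C0.le] at h1
    have h2 := mul_rpow_strict (div_pos D0 C0) ((div_lt_one C0).2 hlt) hr0
    rw [Real.one_rpow] at h2
    linarith
  rw [← hC]
  refine ⟨Real.rpow_le_rpow C0.le hCD hp0.le, fun he => ?_, ?_⟩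
  · have hDC : D = C := (Real.rpow_left_inj D0.le C0.le hp0.ne').1 he
    have hae := (integral_eq_iff_of_ae_le i1 i2 hle).1 (by
      rw [e1, e2, hDC, div_self (Real.rpow_pos_of_pos C0 r).ne', mul_one])
    have hsupp : ∀ u : EuclideanSpace ℝ (Fin n), ‖u‖ = 1 → supp K u = A / B * supp L u := by
      intro u hu
      have h1 := (hpt u hu).2 (sphMeas_eq hn
        ((((width_continuousOn hK r).div_const _).const_mul _).add
          (((width_continuousOn hL r).div_const _).const_mul _) |>.const_mul r)
        (((width_continuousOn hM r).div_const _).const_mul r) hae hu)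
      field_simp at h1 ⊢
      linarith
    have hc : 0 < A / B := div_pos A0 B0
    refine ⟨A / B, hc, ?_⟩
    have hsupp' : ∀ u : EuclideanSpace ℝ (Fin n), ‖u‖ = 1 →
        supp K u = supp ((A / B) • L) u := by
      intro u hu
      rw [supp_smul_set _ hc.le, hsupp u hu]
    have nK : K.Nonempty := ⟨0, interior_subset hK.2.2⟩
    have nL : L.Nonempty := ⟨0, interior_subset hL.2.2⟩
    apply Subset.antisymm
    · exact subset_of_supp_le hK.1 (hL.1.smul _) (hL.2.1.smul _) nL.smul_set
        fun u hu => (hsupp' u hu).le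
    · exact subset_of_supp_le (hL.1.smul _) hK.1 hK.2.1 nK fun u hu => (hsupp' u hu).ge
  · rintro ⟨c, hc, hKL⟩
    have hsK : ∀ u : EuclideanSpace ℝ (Fin n), ‖u‖ = 1 → supp K u = c * supp L u := by
      intro u hu
      rw [hKL, supp_smul_set _ hc.le]
    have hk : 0 < (1 - α) * c ^ p + α := by positivity
    obtain ⟨k, k0, hkp⟩ : ∃ k : ℝ, 0 < k ∧ k ^ p = (1 - α) * c ^ p + α :=
      ⟨((1 - α) * c ^ p + α) ^ p⁻¹, by positivity, Real.rpow_inv_rpow hk.le hp0.ne'⟩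
    have hsM : ∀ u : EuclideanSpace ℝ (Fin n), ‖u‖ = 1 → supp M u = k * supp L u := by
      intro u hu
      have hl := supp_pos hL hu
      refine (Real.rpow_left_inj (supp_pos hM hu).le (by positivity) hp0.ne').1 ?_
      rw [hMsupp u hu, hsK u hu, Real.mul_rpow hc.le hl.le, Real.mul_rpow k0.le hl.le, hkp]
      ring
    have hAB : A = c * B := widthFunctional_scale hn hL hr0 hc hsK
    have hDB : D = k * B := widthFunctional_scale hn hL hr0 k0 hsM
    rw [hC, hDB, hAB, Real.mul_rpow hc.le B0.le, Real.mul_rpow k0.le B0.le, hkp]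
    ring
end

section
/- (Proposition 4.2, Hadwiger's Brunn–Minkowski inequality for moments of inertia.) Let n ≥ 1 and let K, L be convex bodies in ℝⁿ. Then I(K + L)^{1/(n+2)} ≥ I(K)^{1/(n+2)} + I(L)^{1/(n+2)}, where K + L is the Minkowski sum, I(K) = ∫_K |x - c_K|² dx, and c_K = (1/V_n(K)) ∫_K x dx is the centroid of K. -/
open scoped Pointwise
open MeasureTheory

/-- The centroid of a set: `c_K = (1/V_n(K)) ∫_K x dx`. -/
noncomputable def centroid {n : ℕ} (K : Set (EuclideanSpace ℝ (Fin n))) :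
    EuclideanSpace ℝ (Fin n) :=
  (volume K).toReal⁻¹ • ∫ x in K, x

/-- The moment of inertia of a set: `I(K) = ∫_K |x - c_K|² dx`. -/
noncomputable def inertia {n : ℕ} (K : Set (EuclideanSpace ℝ (Fin n))) : ℝ :=
  ∫ x in K, ‖x - centroid K‖ ^ 2

open scoped ENNReal

lemma bm_one {A B C : Set ℝ} (hA : MeasurableSet A) (hB : MeasurableSet B)
    (hAn : A.Nonempty) (hBn : B.Nonempty) (h : ∀ a ∈ A, ∀ b ∈ B, a + b ∈ C) :
    volume A + volume B ≤ volume C := by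
  have key : ∀ K₁ ⊆ A, IsCompact K₁ → ∀ K₂ ⊆ B, IsCompact K₂ → K₁.Nonempty → K₂.Nonempty →
      volume K₁ + volume K₂ ≤ volume C := by
    intro K₁ h1 c1 K₂ h2 c2 n1 n2
    obtain ⟨a, ha, hamax⟩ := c1.exists_isMaxOn n1 continuousOn_id
    obtain ⟨b, hb, hbmin⟩ := c2.exists_isMinOn n2 continuousOn_id
    have e1 : volume ((fun x => x + b) '' K₁) = volume K₁ := by simp
    have e2 : volume ((fun x => a + x) '' K₂) = volume K₂ := by simp
    have m2 : MeasurableSet ((fun x => a + x) '' K₂) :=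
      (c2.image (by fun_prop)).measurableSet
    have hd : AEDisjoint volume ((fun x => x + b) '' K₁) ((fun x => a + x) '' K₂) := by
      refine measure_mono_null (t := {a + b}) ?_ (by simp)
      rintro z ⟨⟨x, hx, rfl⟩, ⟨y, hy, hxy⟩⟩
      have h3 : x ≤ a := hamax hx
      have h4 : b ≤ y := hbmin hy
      simp only at hxy
      simp only [Set.mem_singleton_iff]
      linarith
    rw [← e1, ← e2, ← measure_union₀ m2.nullMeasurableSet hd]
    apply measure_mono
    rintro z (⟨x, hx, rfl⟩ | ⟨y, hy, rfl⟩)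
    · exact h _ (h1 hx) _ (h2 hb)
    · exact h _ (h1 ha) _ (h2 hy)
  obtain ⟨a0, ha0⟩ := hAn
  obtain ⟨b0, hb0⟩ := hBn
  refine le_of_forall_lt fun r hr => ?_
  by_contra hcon
  push Not at hcon
  have : volume A + volume B ≤ volume C := by
    rw [hA.measure_eq_iSup_isCompact, hB.measure_eq_iSup_isCompact]
    simp only [iSup_and']
    refine ENNReal.biSup_add_biSup_le' ⟨∅, by simp⟩ ⟨∅, by simp⟩ ?_
    rintro K₁ ⟨h1, c1⟩ K₂ ⟨h2, c2⟩
    refine le_trans (add_le_add (measure_mono (Set.subset_insert a0 K₁))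
      (measure_mono (Set.subset_insert b0 K₂))) ?_
    exact key _ (Set.insert_subset ha0 h1) (c1.insert a0) _ (Set.insert_subset hb0 h2)
      (c2.insert b0) (Set.insert_nonempty _ _) (Set.insert_nonempty _ _)
  exact absurd (lt_of_lt_of_le hr this) (not_lt.2 hcon)

lemma bm_one_scaled {A B C : Set ℝ} (hA : MeasurableSet A) (hB : MeasurableSet B)
    (hAn : A.Nonempty) (hBn : B.Nonempty) {l m : ℝ} (hl : 0 < l) (hm : 0 < m)
    (h : ∀ a ∈ A, ∀ b ∈ B, l * a + m * b ∈ C) :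
    ENNReal.ofReal l * volume A + ENNReal.ofReal m * volume B ≤ volume C := by
  have e : ∀ (r : ℝ), 0 < r → ∀ S : Set ℝ, volume (r • S) = ENNReal.ofReal r * volume S := by
    intro r hr S
    rw [Measure.addHaar_smul]; simp [abs_of_pos hr]
  rw [← e l hl, ← e m hm]
  refine bm_one (hA.const_smul_of_ne_zero hl.ne') (hB.const_smul_of_ne_zero hm.ne')
    hAn.smul_set hBn.smul_set ?_
  rintro _ ⟨a, ha, rfl⟩ _ ⟨b, hb, rfl⟩
  exact h a ha b hb

lemma ennreal_amgm (a b : ℝ≥0∞) {l m : ℝ} (hl : 0 < l) (hm : 0 < m) (hlm : l + m = 1) :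
    a ^ l * b ^ m ≤ ENNReal.ofReal l * a + ENNReal.ofReal m * b := by
  by_cases ha : a = ∞
  · subst ha; simp [ENNReal.mul_top, hl]
  by_cases hb : b = ∞
  · subst hb; simp [ENNReal.mul_top, hm]
  lift a to NNReal using ha
  lift b to NNReal using hb
  have := NNReal.geom_mean_le_arith_mean2_weighted l.toNNReal m.toNNReal a b
    (by rw [← Real.toNNReal_add hl.le hm.le, hlm]; simp)
  rw [Real.coe_toNNReal _ hl.le, Real.coe_toNNReal _ hm.le] at this
  rw [← ENNReal.coe_rpow_of_nonneg _ hl.le, ← ENNReal.coe_rpow_of_nonneg _ hm.le]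
  simp only [ENNReal.ofReal]
  exact_mod_cast this

/-- layer cake on `(0,1)` -/
lemma layer_unit {f : ℝ → ℝ≥0∞} (hf : Measurable f) (h1 : ∀ x, f x ≤ 1) :
    ∫⁻ x, f x = ∫⁻ t in Set.Ioo (0 : ℝ) 1, volume {x | ENNReal.ofReal t < f x} := by
  have hfin : ∀ x, f x ≠ ∞ := fun x => ((h1 x).trans_lt (by simp)).ne
  have h := lintegral_eq_lintegral_meas_lt (volume : Measure ℝ) (f := fun x => (f x).toReal)
    (Filter.Eventually.of_forall fun x => by simp) hf.ennreal_toReal.aemeasurable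
  simp only [ENNReal.ofReal_toReal (hfin _)] at h
  rw [h]
  have hs : ∀ t : ℝ, 0 < t → {x | t < (f x).toReal} = {x | ENNReal.ofReal t < f x} := by
    intro t ht
    ext x
    simp only [Set.mem_ofPred_eq]
    rw [ENNReal.ofReal_lt_iff_lt_toReal ht.le (hfin x)]
  have hu : Set.Ioi (0 : ℝ) = Set.Ioo 0 1 ∪ Set.Ici 1 := by
    ext x; simp only [Set.mem_Ioi, Set.mem_union, Set.mem_Ioo, Set.mem_Ici]
    constructor
    · intro h; rcases lt_or_ge x 1 with h' | h'
      · left; exact ⟨h, h'⟩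
      · right; exact h'
    · rintro (h | h) <;> linarith [h]
  rw [hu, lintegral_union measurableSet_Ici]
  · have : ∫⁻ t in Set.Ici (1 : ℝ), volume {x | t < (f x).toReal} = 0 := by
      rw [← lintegral_zero (μ := volume.restrict (Set.Ici (1 : ℝ)))]
      refine setLIntegral_congr_fun measurableSet_Ici fun t ht => ?_
      have : {x | t < (f x).toReal} = ∅ := by
        ext x
        simp only [Set.mem_ofPred_eq, Set.mem_empty_iff_false, iff_false, not_lt]
        refine le_trans ?_ ht
        have := ENNReal.toReal_mono (by simp) (h1 x)
        simpa using this
      simp [this]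
    rw [this, add_zero]
    refine setLIntegral_congr_fun measurableSet_Ioo fun t ht => ?_
    simp only [hs t ht.1]
  · rw [Set.disjoint_left]
    intro x hx hx'
    exact absurd hx.2 (not_lt.2 hx')

lemma pl_one_norm {f g h : ℝ → ℝ≥0∞} (hf : Measurable f) (hg : Measurable g) (hh : Measurable h)
    {l m : ℝ} (hl : 0 < l) (hm : 0 < m) (hlm : l + m = 1)
    (H : ∀ x y, f x ^ l * g y ^ m ≤ h (l * x + m * y))
    (hf1 : ⨆ x, f x = 1) (hg1 : ⨆ x, g x = 1) :
    (∫⁻ x, f x) ^ l * (∫⁻ x, g x) ^ m ≤ ∫⁻ x, h x := by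
  have hfl : ∀ x, f x ≤ 1 := fun x => hf1 ▸ le_iSup f x
  have hgl : ∀ x, g x ≤ 1 := fun x => hg1 ▸ le_iSup g x
  refine (ennreal_amgm _ _ hl hm hlm).trans ?_
  refine le_trans ?_ (lintegral_mono (f := fun x => min (h x) 1) fun x => min_le_left _ _)
  rw [layer_unit hf hfl, layer_unit hg hgl, layer_unit (hh.min measurable_const)
    (fun x => min_le_right _ _)]
  have anti : ∀ k : ℝ → ℝ≥0∞, Measurable fun t : ℝ => volume {x | ENNReal.ofReal t < k x} := by
    intro k
    refine Antitone.measurable fun s t hst => measure_mono fun x hx => ?_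
    exact lt_of_le_of_lt (ENNReal.ofReal_le_ofReal hst) hx
  rw [← lintegral_const_mul _ (anti f), ← lintegral_const_mul _ (anti g),
    ← lintegral_add_left ((anti f).const_mul _)]
  refine setLIntegral_mono' measurableSet_Ioo fun t ht => ?_
  have ht1 : ENNReal.ofReal t < 1 := by
    rw [← ENNReal.ofReal_one]; exact (ENNReal.ofReal_lt_ofReal_iff one_pos).2 ht.2
  refine bm_one_scaled (measurableSet_lt measurable_const hf)
    (measurableSet_lt measurable_const hg) ?_ ?_ hl hm ?_
  · rw [← hf1] at ht1; exact lt_iSup_iff.1 ht1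
  · rw [← hg1] at ht1; exact lt_iSup_iff.1 ht1
  · intro a ha b hb
    simp only [Set.mem_ofPred_eq] at ha hb ⊢
    refine lt_min (lt_of_lt_of_le ?_ (H a b)) ht1
    have h0 : ENNReal.ofReal t ≠ 0 := by simp [ht.1]
    calc ENNReal.ofReal t = ENNReal.ofReal t ^ l * ENNReal.ofReal t ^ m := by
          rw [← ENNReal.rpow_add _ _ h0 (by simp), hlm, ENNReal.rpow_one]
      _ < f a ^ l * g b ^ m :=
          ENNReal.mul_lt_mul (ENNReal.rpow_lt_rpow ha hl) (ENNReal.rpow_lt_rpow hb hm)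

lemma pl_one_bdd {f g h : ℝ → ℝ≥0∞} (hf : Measurable f) (hg : Measurable g) (hh : Measurable h)
    {l m : ℝ} (hl : 0 < l) (hm : 0 < m) (hlm : l + m = 1)
    (H : ∀ x y, f x ^ l * g y ^ m ≤ h (l * x + m * y))
    (hf1 : ⨆ x, f x ≠ ∞) (hg1 : ⨆ x, g x ≠ ∞) :
    (∫⁻ x, f x) ^ l * (∫⁻ x, g x) ^ m ≤ ∫⁻ x, h x := by
  set F := ⨆ x, f x with hF
  set G := ⨆ x, g x with hG
  by_cases hF0 : F = 0
  · have : ∀ x, f x = 0 := by simpa [hF] using hF0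
    simp [this, hl]
  by_cases hG0 : G = 0
  · have : ∀ x, g x = 0 := by simpa [hG] using hG0
    simp [this, hm]
  have hc0 : F ^ l * G ^ m ≠ 0 := by
    simp [hF0, hG0, hf1, hg1]
  have hct : F ^ l * G ^ m ≠ ∞ :=
    ENNReal.mul_ne_top (ENNReal.rpow_ne_top_of_nonneg hl.le hf1)
      (ENNReal.rpow_ne_top_of_nonneg hm.le hg1)
  have key := pl_one_norm (f := fun x => F⁻¹ * f x) (g := fun x => G⁻¹ * g x)
    (h := fun x => (F ^ l * G ^ m)⁻¹ * h x) (hf.const_mul _) (hg.const_mul _) (hh.const_mul _)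
    hl hm hlm ?_ ?_ ?_
  · rw [lintegral_const_mul _ hf, lintegral_const_mul _ hg, lintegral_const_mul _ hh,
      ENNReal.mul_rpow_of_nonneg _ _ hl.le, ENNReal.mul_rpow_of_nonneg _ _ hm.le,
      mul_mul_mul_comm, ENNReal.inv_rpow, ENNReal.inv_rpow, ← ENNReal.mul_inv (by simp [hf1, hF0]) (by simp [hF0, hf1, hl])] at key
    exact (ENNReal.mul_le_mul_iff_right (by simpa using hct) (by simpa using hc0)).1 key
  · intro x y
    rw [ENNReal.mul_rpow_of_nonneg _ _ hl.le, ENNReal.mul_rpow_of_nonneg _ _ hm.le,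
      mul_mul_mul_comm, ENNReal.inv_rpow, ENNReal.inv_rpow, ← ENNReal.mul_inv (by simp [hf1, hF0]) (by simp [hF0, hf1, hl])]
    gcongr
    exact H x y
  · rw [← ENNReal.mul_iSup, ← hF, ENNReal.inv_mul_cancel hF0 hf1]
  · rw [← ENNReal.mul_iSup, ← hG, ENNReal.inv_mul_cancel hG0 hg1]

lemma tendsto_trunc {f : ℝ → ℝ≥0∞} (hf : Measurable f) :
    Filter.Tendsto (fun k : ℕ => ∫⁻ x, min (f x) k) Filter.atTop (nhds (∫⁻ x, f x)) := by
  refine lintegral_tendsto_of_tendsto_of_monotone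
    (fun k => (hf.min measurable_const).aemeasurable) ?_ ?_
  · refine Filter.Eventually.of_forall fun x i j hij => ?_
    exact min_le_min le_rfl (by exact_mod_cast hij)
  · refine Filter.Eventually.of_forall fun x => ?_
    have := (tendsto_const_nhds (x := f x) (f := Filter.atTop)).min ENNReal.tendsto_nat_nhds_top
    simpa using this

lemma pl_one {f g h : ℝ → ℝ≥0∞} (hf : Measurable f) (hg : Measurable g) (hh : Measurable h)
    {l m : ℝ} (hl : 0 < l) (hm : 0 < m) (hlm : l + m = 1)
    (H : ∀ x y, f x ^ l * g y ^ m ≤ h (l * x + m * y)) :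
    (∫⁻ x, f x) ^ l * (∫⁻ x, g x) ^ m ≤ ∫⁻ x, h x := by
  by_cases hf0 : ∫⁻ x, f x = 0
  · simp [hf0, hl]
  by_cases hg0 : ∫⁻ x, g x = 0
  · simp [hg0, hm]
  have t : Filter.Tendsto (fun k : ℕ => (∫⁻ x, min (f x) k) ^ l * (∫⁻ x, min (g x) k) ^ m)
      Filter.atTop (nhds ((∫⁻ x, f x) ^ l * (∫⁻ x, g x) ^ m)) := by
    refine ENNReal.Tendsto.mul
      ((ENNReal.continuous_rpow_const.tendsto _).comp (tendsto_trunc hf)) ?_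
      ((ENNReal.continuous_rpow_const.tendsto _).comp (tendsto_trunc hg)) ?_
    · left; simp [hf0, hl.not_gt]
    · left; simp [hg0, hm.not_gt]
  refine le_of_tendsto' t fun k => ?_
  refine pl_one_bdd (hf.min measurable_const) (hg.min measurable_const) hh hl hm hlm ?_ ?_ ?_
  · intro x y
    refine le_trans ?_ (H x y)
    gcongr <;> exact min_le_left _ _
  · exact ((iSup_le fun x => min_le_right _ _).trans_lt (ENNReal.natCast_lt_top k)).ne
  · exact ((iSup_le fun x => min_le_right _ _).trans_lt (ENNReal.natCast_lt_top k)).ne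

lemma pl_pi (n : ℕ) {f g h : (Fin n → ℝ) → ℝ≥0∞} (hf : Measurable f) (hg : Measurable g)
    (hh : Measurable h) {l m : ℝ} (hl : 0 < l) (hm : 0 < m) (hlm : l + m = 1)
    (H : ∀ x y, f x ^ l * g y ^ m ≤ h (l • x + m • y)) :
    (∫⁻ x, f x) ^ l * (∫⁻ x, g x) ^ m ≤ ∫⁻ x, h x := by
  induction n with
  | zero =>
    have : ∀ k : (Fin 0 → ℝ) → ℝ≥0∞, ∫⁻ x, k x = k 0 := by
      intro k
      have : k = fun _ => k 0 := by funext x; rw [Subsingleton.elim x 0]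
      rw [this, lintegral_const]
      have hv : volume (Set.univ : Set (Fin 0 → ℝ)) = 1 := by simp [volume_pi]
      rw [hv, mul_one]
    simp only [this]
    have := H 0 0
    simpa using this
  | succ n ih =>
    let e := MeasurableEquiv.piFinSuccAbove (fun _ : Fin (n+1) => ℝ) 0
    have he : MeasurePreserving e.symm := (volume_preserving_piFinSuccAbove (fun _ : Fin (n+1) => ℝ) 0).symm
    have hint : ∀ k : (Fin (n+1) → ℝ) → ℝ≥0∞, Measurable k →
        ∫⁻ x, k x = ∫⁻ t : ℝ, ∫⁻ y : Fin n → ℝ, k (e.symm (t, y)) := by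
      intro k hk
      rw [← he.lintegral_comp hk]
      exact lintegral_prod _ (hk.comp e.symm.measurable).aemeasurable
    have hadd : ∀ a b s t, e.symm (l * s + m * t, l • a + m • b)
        = l • e.symm (s, a) + m • e.symm (t, b) := by
      intro a b s t
      apply e.injective
      rw [e.apply_symm_apply]
      ext <;> simp [e, MeasurableEquiv.piFinSuccAbove, Fin.insertNthEquiv, Fin.tail]
    have hmeas : ∀ k : (Fin (n+1) → ℝ) → ℝ≥0∞, Measurable k →
        Measurable fun t : ℝ => ∫⁻ y : Fin n → ℝ, k (e.symm (t, y)) := fun k hk =>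
      Measurable.lintegral_prod_right' (f := fun p => k (e.symm p)) (hk.comp e.symm.measurable)
    rw [hint f hf, hint g hg, hint h hh]
    refine pl_one (hmeas f hf) (hmeas g hg) (hmeas h hh) hl hm hlm fun s t => ?_
    refine ih ?_ ?_ ?_ fun a b => ?_
    · exact hf.comp (e.symm.measurable.comp (by fun_prop))
    · exact hg.comp (e.symm.measurable.comp (by fun_prop))
    · exact hh.comp (e.symm.measurable.comp (by fun_prop))
    · rw [hadd]; exact H _ _

lemma pl_euclid {n : ℕ} {f g h : EuclideanSpace ℝ (Fin n) → ℝ≥0∞} (hf : Measurable f)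
    (hg : Measurable g)
    (hh : Measurable h) {l m : ℝ} (hl : 0 < l) (hm : 0 < m) (hlm : l + m = 1)
    (H : ∀ x y, f x ^ l * g y ^ m ≤ h (l • x + m • y)) :
    (∫⁻ x, f x) ^ l * (∫⁻ x, g x) ^ m ≤ ∫⁻ x, h x := by
  have hp := PiLp.volume_preserving_toLp (Fin n)
  rw [← hp.lintegral_comp hf, ← hp.lintegral_comp hg, ← hp.lintegral_comp hh]
  exact pl_pi n (hf.comp hp.measurable) (hg.comp hp.measurable) (hh.comp hp.measurable) hl hm hlm
    fun x y => H _ _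

/-- half moment -/
noncomputable def Jp {n : ℕ} (K : Set (EuclideanSpace ℝ (Fin n))) (u : EuclideanSpace ℝ (Fin n))
    (s : ℝ) : ℝ := ∫ x in K, (max (inner ℝ u x - s) 0) ^ 2

noncomputable def Jq {n : ℕ} (K : Set (EuclideanSpace ℝ (Fin n))) (u : EuclideanSpace ℝ (Fin n))
    (s : ℝ) : ℝ := ∫ x in K, (inner ℝ u x - s) ^ 2

lemma real_pl_core {a b c l m : ℝ} (ha : 0 ≤ a) (hb : 0 ≤ b) (hl : 0 < l) (hm : 0 < m)
    (hlm : l + m = 1) (h : 0 < a → 0 < b → l * a + m * b ≤ c) :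
    (a ^ 2) ^ l * (b ^ 2) ^ m ≤ c ^ 2 := by
  rcases ha.eq_or_lt with rfl | ha'
  · simp [Real.zero_rpow hl.ne', sq_nonneg]
  rcases hb.eq_or_lt with rfl | hb'
  · simp [Real.zero_rpow hm.ne', sq_nonneg]
  have h1 := Real.geom_mean_le_arith_mean2_weighted hl.le hm.le ha hb hlm
  have e : (a ^ 2) ^ l * (b ^ 2) ^ m = (a ^ l * b ^ m) ^ 2 := by
    rw [mul_pow, ← Real.rpow_natCast, ← Real.rpow_natCast, ← Real.rpow_natCast (a ^ l),
      ← Real.rpow_natCast (b ^ m), ← Real.rpow_mul ha, ← Real.rpow_mul hb, ← Real.rpow_mul ha,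
      ← Real.rpow_mul hb, mul_comm l, mul_comm m]
  rw [e]
  exact pow_le_pow_left₀ (by positivity) (h1.trans (h ha' hb')) 2

lemma half_pl {n : ℕ} {K L : Set (EuclideanSpace ℝ (Fin n))} (hK : IsCompact K) (hL : IsCompact L)
    (u : EuclideanSpace ℝ (Fin n)) (s t : ℝ) {l m : ℝ} (hl : 0 < l) (hm : 0 < m)
    (hlm : l + m = 1) :
    ((l ^ (n + 2))⁻¹ * Jp K u s) ^ l * ((m ^ (n + 2))⁻¹ * Jp L u t) ^ m
      ≤ Jp (K + L) u (s + t) := by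
  have hKL : IsCompact (K + L) := hK.add hL
  let F : Set (EuclideanSpace ℝ (Fin n)) → ℝ → ℝ → EuclideanSpace ℝ (Fin n) → ℝ :=
    fun M s r => M.indicator fun y => (max (inner ℝ u y - s) 0 / r) ^ 2
  have Fint : ∀ M s r, IsCompact M → Integrable (F M s r) := by
    intro M s r hM
    refine IntegrableOn.integrable_indicator ?_ hM.measurableSet
    exact ContinuousOn.integrableOn_compact hM (by fun_prop)
  have Fmeas : ∀ M s r, IsCompact M → Measurable (F M s r) := by
    intro M s r hM
    refine Measurable.indicator ?_ hM.measurableSet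
    fun_prop
  have Fnn : ∀ M s r x, 0 ≤ F M s r x := by
    intro M s r x
    exact Set.indicator_nonneg (fun _ _ => sq_nonneg _) _
  have Fval : ∀ M s r, IsCompact M → 0 < r →
      ∫⁻ x, ENNReal.ofReal (F M s r (r • x)) =
        ENNReal.ofReal ((r ^ (n + 2))⁻¹ * Jp M u s) := by
    intro M s r hM hr
    rw [← ofReal_integral_eq_lintegral_ofReal ((Fint M s r hM).comp_smul hr.ne')
      (Filter.Eventually.of_forall fun x => Fnn _ _ _ _)]
    congr 1
    rw [Measure.integral_comp_smul_of_nonneg volume (F M s r) r (hR := hr.le), integral_indicator hM.measurableSet]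
    simp only [div_pow, integral_div, finrank_euclideanSpace, Fintype.card_fin, smul_eq_mul, Jp]
    rw [pow_add]
    field_simp
  have main := pl_euclid (f := fun x => ENNReal.ofReal (F K s l (l • x)))
    (g := fun x => ENNReal.ofReal (F L t m (m • x)))
    (h := fun x => ENNReal.ofReal (F (K + L) (s + t) 1 ((1:ℝ) • x)))
    (((Fmeas K s l hK).comp (measurable_const_smul l)).ennreal_ofReal)
    (((Fmeas L t m hL).comp (measurable_const_smul m)).ennreal_ofReal)
    (((Fmeas (K + L) (s + t) 1 hKL).comp (measurable_const_smul 1)).ennreal_ofReal)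
    hl hm hlm ?_
  · rw [Fval K s l hK hl, Fval L t m hL hm, Fval _ _ 1 hKL one_pos] at main
    have nn : ∀ M s, 0 ≤ Jp M u s := fun M s => integral_nonneg fun x => sq_nonneg _
    have p1 : 0 ≤ (l ^ (n + 2))⁻¹ * Jp K u s := mul_nonneg (by positivity) (nn _ _)
    have p2 : 0 ≤ (m ^ (n + 2))⁻¹ * Jp L u t := mul_nonneg (by positivity) (nn _ _)
    rw [ENNReal.ofReal_rpow_of_nonneg p1 hl.le, ENNReal.ofReal_rpow_of_nonneg p2 hm.le,
      ← ENNReal.ofReal_mul (by positivity), one_pow, inv_one, one_mul,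
      ENNReal.ofReal_le_ofReal_iff (nn _ _)] at main
    exact main
  · intro x y
    rw [ENNReal.ofReal_rpow_of_nonneg (Fnn _ _ _ _) hl.le,
      ENNReal.ofReal_rpow_of_nonneg (Fnn _ _ _ _) hm.le,
      ← ENNReal.ofReal_mul (Real.rpow_nonneg (Fnn _ _ _ _) _)]
    apply ENNReal.ofReal_le_ofReal
    by_cases hx : l • x ∈ K
    swap
    · have : F K s l (l • x) = 0 := Set.indicator_of_notMem hx _
      rw [this, Real.zero_rpow hl.ne', zero_mul]; exact Fnn _ _ _ _
    by_cases hy : m • y ∈ L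
    swap
    · have : F L t m (m • y) = 0 := Set.indicator_of_notMem hy _
      rw [this, Real.zero_rpow hm.ne', mul_zero]; exact Fnn _ _ _ _
    have hz : (1:ℝ) • (l • x + m • y) ∈ K + L := by rw [one_smul]; exact Set.add_mem_add hx hy
    have e1 : F K s l (l • x) = _ := Set.indicator_of_mem hx _
    have e2 : F L t m (m • y) = _ := Set.indicator_of_mem hy _
    have e3 : F (K + L) (s + t) 1 ((1:ℝ) • (l • x + m • y)) = _ := Set.indicator_of_mem hz _
    rw [e1, e2, e3]
    refine real_pl_core (by positivity) (by positivity) hl hm hlm ?_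
    intro h1 h2
    have q1 : 0 < inner ℝ u (l • x) - s := by
      by_contra hcon
      rw [max_eq_right (not_lt.1 hcon)] at h1; simp at h1
    have q2 : 0 < inner ℝ u (m • y) - t := by
      by_contra hcon
      rw [max_eq_right (not_lt.1 hcon)] at h2; simp at h2
    rw [max_eq_left q1.le, max_eq_left q2.le, div_one, mul_div_cancel₀ _ hl.ne',
      mul_div_cancel₀ _ hm.ne']
    refine le_trans (le_of_eq ?_) (le_max_left _ _)
    rw [one_smul, inner_add_right]; ring

lemma half_bm {n : ℕ} {K L : Set (EuclideanSpace ℝ (Fin n))} (hK : IsCompact K) (hL : IsCompact L)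
    (u : EuclideanSpace ℝ (Fin n)) (s t : ℝ) (h1 : 0 < Jp K u s) (h2 : 0 < Jp L u t) :
    (Jp K u s ^ ((1 : ℝ) / (n + 2)) + Jp L u t ^ ((1 : ℝ) / (n + 2))) ^ (n + 2)
      ≤ Jp (K + L) u (s + t) := by
  set A := Jp K u s
  set B := Jp L u t
  set a := A ^ ((1 : ℝ) / (n + 2)) with ha
  set b := B ^ ((1 : ℝ) / (n + 2)) with hb
  have ha0 : 0 < a := Real.rpow_pos_of_pos h1 _
  have hb0 : 0 < b := Real.rpow_pos_of_pos h2 _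
  have key : ∀ X : ℝ, 0 < X → (X ^ ((1 : ℝ) / (n + 2))) ^ (n + 2) = X := by
    intro X hX
    rw [← Real.rpow_natCast, ← Real.rpow_mul hX.le]
    push_cast
    rw [one_div_mul_cancel (by positivity), Real.rpow_one]
  have eA : a ^ (n + 2) = A := key A h1
  have eB : b ^ (n + 2) = B := key B h2
  have hlm : a / (a + b) + b / (a + b) = 1 := by field_simp
  have := half_pl hK hL u s t (l := a / (a + b)) (m := b / (a + b)) (by positivity) (by positivity)
    hlm
  refine le_trans (le_of_eq ?_) this
  change _ = (_ * A) ^ _ * (_ * B) ^ _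
  have f1 : ((a / (a + b)) ^ (n + 2))⁻¹ * A = (a + b) ^ (n + 2) := by
    rw [← eA, div_pow]; field_simp
  have f2 : ((b / (a + b)) ^ (n + 2))⁻¹ * B = (a + b) ^ (n + 2) := by
    rw [← eB, div_pow]; field_simp
  rw [f1, f2, ← Real.rpow_add (by positivity), hlm, Real.rpow_one]

lemma Jp_cont {n : ℕ} {K : Set (EuclideanSpace ℝ (Fin n))} (hK : IsCompact K)
    (u : EuclideanSpace ℝ (Fin n)) : Continuous (Jp K u) := by
  unfold Jp
  exact continuous_parametric_integral_of_continuous (by fun_prop) hK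

lemma Jp_nonneg {n : ℕ} (K : Set (EuclideanSpace ℝ (Fin n)))
    (u : EuclideanSpace ℝ (Fin n)) (s : ℝ) : 0 ≤ Jp K u s := integral_nonneg fun x => sq_nonneg _

lemma Jq_eq {n : ℕ} {K : Set (EuclideanSpace ℝ (Fin n))} (hK : IsCompact K)
    (u : EuclideanSpace ℝ (Fin n)) (s : ℝ) : Jq K u s = Jp K u s + Jp K (-u) (-s) := by
  unfold Jq Jp
  rw [← integral_add]
  · congr 1
    funext x
    rw [inner_neg_left]
    rcases le_total (inner ℝ u x - s) 0 with h | h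
    · rw [max_eq_right h, max_eq_left (by linarith)]; ring
    · rw [max_eq_left h, max_eq_right (by linarith)]; ring
  · exact ContinuousOn.integrableOn_compact hK (by fun_prop)
  · exact ContinuousOn.integrableOn_compact hK (by fun_prop)

lemma Jp_zero {n : ℕ} {K : Set (EuclideanSpace ℝ (Fin n))} (hK : IsCompact K)
    (u : EuclideanSpace ℝ (Fin n)) {s : ℝ} (h : ∀ x ∈ K, inner ℝ u x ≤ s) : Jp K u s = 0 := by
  unfold Jp
  rw [setIntegral_congr_fun (g := fun _ => (0:ℝ)) hK.measurableSet]
  · simp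
  · intro x hx
    simp [h x hx]

lemma rpow_scale {n : ℕ} {θ A B : ℝ} (hθ : 0 ≤ θ) (hA : 0 ≤ A) (hB : 0 ≤ B) :
    ((θ * A) ^ ((1 : ℝ) / (n + 2)) + (θ * B) ^ ((1 : ℝ) / (n + 2))) ^ (n + 2)
     = θ * (A ^ ((1 : ℝ) / (n + 2)) + B ^ ((1 : ℝ) / (n + 2))) ^ (n + 2) := by
  rw [Real.mul_rpow hθ hA, Real.mul_rpow hθ hB, ← mul_add, mul_pow]
  congr 1
  rw [← Real.rpow_natCast, ← Real.rpow_mul hθ]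
  push_cast
  rw [one_div_mul_cancel (by positivity), Real.rpow_one]

lemma half_theta {n : ℕ} {K L : Set (EuclideanSpace ℝ (Fin n))} (hK : IsCompact K)
    (hL : IsCompact L) (u : EuclideanSpace ℝ (Fin n)) (s t : ℝ) {θ A B : ℝ} (hθ : 0 ≤ θ)
    (hA : 0 < A) (hB : 0 < B) (h1 : Jp K u s = θ * A) (h2 : Jp L u t = θ * B) :
    θ * (A ^ ((1 : ℝ) / (n + 2)) + B ^ ((1 : ℝ) / (n + 2))) ^ (n + 2)
      ≤ Jp (K + L) u (s + t) := by
  rcases hθ.eq_or_lt with rfl | hθ'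
  · rw [zero_mul]; exact Jp_nonneg _ _ _
  rw [← rpow_scale hθ hA.le hB.le, ← h1, ← h2]
  exact half_bm hK hL u s t (h1 ▸ by positivity) (h2 ▸ by positivity)

lemma dir_bm {n : ℕ} {K L : Set (EuclideanSpace ℝ (Fin n))} (hK : IsCompact K)
    (hL : IsCompact L) (u : EuclideanSpace ℝ (Fin n)) (c : ℝ)
    (pK : ∀ s, 0 < Jq K u s) (pL : ∀ s, 0 < Jq L u s) :
    ∃ s t, (Jq K u s ^ ((1 : ℝ) / (n + 2)) + Jq L u t ^ ((1 : ℝ) / (n + 2))) ^ (n + 2)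
      ≤ Jq (K + L) u c := by
  have bd : ∀ M : Set (EuclideanSpace ℝ (Fin n)), IsCompact M →
      ∃ R : ℝ, 0 ≤ R ∧ ∀ x ∈ M, |inner ℝ u x| ≤ R := by
    intro M hM
    obtain ⟨R, hR⟩ := hM.exists_bound_of_continuousOn (f := fun x => inner ℝ u x)
      (by fun_prop)
    exact ⟨max R 0, le_max_right _ _, fun x hx => (hR x hx).trans (le_max_left _ _)⟩
  obtain ⟨R1, hR1, b1⟩ := bd K hK
  obtain ⟨R2, hR2, b2⟩ := bd L hL
  let G : ℝ → ℝ := fun s => Jp K u s * Jp L (-u) (-(c - s)) - Jp L u (c - s) * Jp K (-u) (-s)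
  have hG : Continuous G := by
    have i1 := Jp_cont hK u
    have i2 := Jp_cont hL u
    have i3 := Jp_cont hK (-u)
    have i4 := Jp_cont hL (-u)
    fun_prop
  set S := R1 + R2 + |c| with hS
  have hc1 := le_abs_self c
  have hc2 := neg_abs_le c
  have hlow : 0 ≤ G (-S) := by
    have z1 : Jp K (-u) (- -S) = 0 := Jp_zero hK _ fun x hx => by
      rw [inner_neg_left]; linarith [(abs_le.1 (b1 x hx)).1]
    simp only [G]
    rw [z1, mul_zero, sub_zero]
    exact mul_nonneg (Jp_nonneg _ _ _) (Jp_nonneg _ _ _)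
  have hhigh : G S ≤ 0 := by
    have z1 : Jp K u S = 0 := Jp_zero hK _ fun x hx => by
      linarith [(abs_le.1 (b1 x hx)).2]
    simp only [G]
    rw [z1, zero_mul, zero_sub, neg_nonpos]
    exact mul_nonneg (Jp_nonneg _ _ _) (Jp_nonneg _ _ _)
  obtain ⟨s, hs⟩ := mem_range_of_exists_le_of_exists_ge hG ⟨S, hhigh⟩ ⟨-S, hlow⟩
  refine ⟨s, c - s, ?_⟩
  have hA := pK s
  have hB := pL (c - s)
  have eA := Jq_eq hK u s
  have eB := Jq_eq hL u (c - s)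
  have eC := Jq_eq (hK.add hL) u c
  set A := Jq K u s
  set B := Jq L u (c - s)
  simp only [G] at hs
  have n1 := Jp_nonneg K u s
  have n2 := Jp_nonneg K (-u) (-s)
  have hAB : Jp L u (c - s) * A = Jp K u s * B := by rw [eA, eB]; linarith
  have hAB2 : Jp L (-u) (-(c - s)) * A = Jp K (-u) (-s) * B := by rw [eA, eB]; linarith
  have t1 := half_theta hK hL u s (c - s) (θ := Jp K u s / A) (by positivity) hA hB
    (by field_simp) (by field_simp; linarith)
  have t2 := half_theta hK hL (-u) (-s) (-(c - s)) (θ := Jp K (-u) (-s) / A) (by positivity) hA hB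
    (by field_simp) (by field_simp; linarith)
  rw [show s + (c - s) = c by ring] at t1
  rw [show -s + -(c - s) = -c by ring] at t2
  rw [eC]
  refine le_trans (le_of_eq ?_) (add_le_add t1 t2)
  rw [← add_mul, ← add_div, ← eA, div_self hA.ne', one_mul]

lemma Jq_pos {n : ℕ} {K : Set (EuclideanSpace ℝ (Fin n))} (hK : IsConvexBody K)
    {u : EuclideanSpace ℝ (Fin n)} (hu : u ≠ 0) (s : ℝ) : 0 < Jq K u s := by
  obtain ⟨hc, -, x, hx⟩ := hK
  unfold Jq
  rw [setIntegral_pos_iff_support_of_nonneg_ae]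
  · have ho : IsOpen ({y : EuclideanSpace ℝ (Fin n) | inner ℝ u y - s ≠ 0} ∩ interior K) :=
      IsOpen.inter (isOpen_ne_fun (by fun_prop) (by fun_prop)) isOpen_interior
    refine lt_of_lt_of_le (ho.measure_pos volume ?_) (measure_mono ?_)
    · by_cases h : inner ℝ u x - s = 0
      · have ht : Filter.Tendsto (fun r : ℝ => x + r • u) (nhdsWithin 0 {0}ᶜ) (nhds x) := by
          have : Continuous fun r : ℝ => x + r • u := by fun_prop
          have h2 := this.tendsto 0
          simp only [zero_smul, add_zero] at h2
          exact h2.mono_left nhdsWithin_le_nhds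
        have h3 := ht.eventually (isOpen_interior.mem_nhds hx)
        obtain ⟨r, hr, hr0⟩ := (h3.and self_mem_nhdsWithin).exists
        refine ⟨x + r • u, ?_, hr⟩
        have hr0' : r ≠ 0 := hr0
        simp only [Set.mem_ofPred_eq]
        rw [inner_add_right, inner_smul_right]
        have h5 : inner ℝ u u ≠ 0 := by simpa using hu
        intro hh
        have : r * inner ℝ u u = 0 := by linarith
        simp [hr0', h5] at this
        exact hu this
      · exact ⟨x, h, hx⟩
    · rintro y ⟨hy, hy'⟩
      exact ⟨pow_ne_zero 2 hy, interior_subset hy'⟩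
  · exact Filter.Eventually.of_forall fun x => sq_nonneg _
  · exact ContinuousOn.integrableOn_compact hc (by fun_prop)

lemma body_vol {n : ℕ} {K : Set (EuclideanSpace ℝ (Fin n))} (hK : IsConvexBody K) :
    0 < (volume K).toReal := by
  obtain ⟨hc, -, hi⟩ := hK
  exact ENNReal.toReal_pos (Measure.measure_pos_of_nonempty_interior _ hi).ne' hc.measure_lt_top.ne

lemma Jq_min {n : ℕ} {K : Set (EuclideanSpace ℝ (Fin n))} (hK : IsConvexBody K)
    (u : EuclideanSpace ℝ (Fin n)) (s : ℝ) : Jq K u (inner ℝ u (centroid K)) ≤ Jq K u s := by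
  have hV := body_vol hK
  have hc := hK.1
  have ii : ∀ f : EuclideanSpace ℝ (Fin n) → ℝ, Continuous f → IntegrableOn f K := fun f hf =>
    hf.continuousOn.integrableOn_compact hc
  have iid : IntegrableOn (fun x : EuclideanSpace ℝ (Fin n) => x) K :=
    continuous_id.continuousOn.integrableOn_compact hc
  have hm : ∫ x in K, inner ℝ u x = (volume K).toReal * inner ℝ u (centroid K) := by
    rw [integral_inner iid, centroid, inner_smul_right]
    field_simp
  set c : ℝ := inner ℝ u (centroid K)
  have e : Jq K u s = Jq K u c + (c - s) ^ 2 * (volume K).toReal := by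
    unfold Jq
    have : ∀ x : EuclideanSpace ℝ (Fin n), (inner ℝ u x - s) ^ 2
        = (inner ℝ u x - c) ^ 2 + ((2 * (c - s)) * inner ℝ u x + ((c - s) ^ 2 - 2 * (c - s) * c)) := by
      intro x; ring
    simp only [this]
    rw [integral_add (ii _ (by fun_prop)) (ii _ (by fun_prop)),
      integral_add (ii _ (by fun_prop)) (ii _ (by fun_prop)), integral_const_mul, hm]
    simp only [integral_const, smul_eq_mul, Measure.real, Measure.restrict_apply_univ]
    ring
  rw [e]
  have : 0 ≤ (c - s) ^ 2 * (volume K).toReal := by positivity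
  linarith

lemma body_add {n : ℕ} {K L : Set (EuclideanSpace ℝ (Fin n))} (hK : IsConvexBody K)
    (hL : IsConvexBody L) : IsConvexBody (K + L) := by
  refine ⟨hK.1.add hL.1, hK.2.1.add hL.2.1, ?_⟩
  obtain ⟨x, hx⟩ := hK.2.2
  obtain ⟨y, hy⟩ := hL.2.2
  refine ⟨x + y, ?_⟩
  exact interior_maximal (Set.add_subset_add interior_subset interior_subset)
    (isOpen_interior.add_right) (Set.add_mem_add hx hy)

/-- directional central moment -/
noncomputable def Iu {n : ℕ} (K : Set (EuclideanSpace ℝ (Fin n))) (u : EuclideanSpace ℝ (Fin n)) :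
    ℝ := Jq K u (inner ℝ u (centroid K))

lemma Iu_bm {n : ℕ} {K L : Set (EuclideanSpace ℝ (Fin n))} (hK : IsConvexBody K)
    (hL : IsConvexBody L) {u : EuclideanSpace ℝ (Fin n)} (hu : u ≠ 0) :
    (Iu K u ^ ((1 : ℝ) / (n + 2)) + Iu L u ^ ((1 : ℝ) / (n + 2))) ^ (n + 2) ≤ Iu (K + L) u := by
  obtain ⟨s, t, h⟩ := dir_bm hK.1 hL.1 u (inner ℝ u (centroid (K + L)))
    (fun s => Jq_pos hK hu s) (fun s => Jq_pos hL hu s)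
  refine le_trans ?_ h
  have h1 := Jq_min hK u s
  have h2 := Jq_min hL u t
  have p1 := (Jq_pos hK hu (inner ℝ u (centroid K))).le
  have p2 := (Jq_pos hL hu (inner ℝ u (centroid L))).le
  have q1 := Real.rpow_nonneg p1 ((1 : ℝ) / (n + 2))
  have q2 := Real.rpow_nonneg p2 ((1 : ℝ) / (n + 2))
  refine pow_le_pow_left₀ (add_nonneg q1 q2) (add_le_add ?_ ?_) _
  · exact Real.rpow_le_rpow p1 h1 (by positivity)
  · exact Real.rpow_le_rpow p2 h2 (by positivity)

/-- inertia operator -/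
noncomputable def inertiaOp {n : ℕ} (K : Set (EuclideanSpace ℝ (Fin n))) (hK : IsCompact K) :
    EuclideanSpace ℝ (Fin n) →ₗ[ℝ] EuclideanSpace ℝ (Fin n) where
  toFun u := ∫ x in K, (inner ℝ (x - centroid K) u : ℝ) • (x - centroid K)
  map_add' u v := by
    rw [← integral_add]
    · simp only [inner_add_right, add_smul]
    · exact ContinuousOn.integrableOn_compact hK (by fun_prop)
    · exact ContinuousOn.integrableOn_compact hK (by fun_prop)
  map_smul' r u := by
    simp only [inner_smul_right, mul_smul, integral_smul, RingHom.id_apply]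

lemma inertiaOp_inner {n : ℕ} {K : Set (EuclideanSpace ℝ (Fin n))} (hK : IsCompact K)
    (u v : EuclideanSpace ℝ (Fin n)) : inner ℝ v (inertiaOp K hK u) =
      ∫ x in K, inner ℝ (x - centroid K) u * inner ℝ (x - centroid K) v := by
  change inner ℝ v (∫ x in K, (inner ℝ (x - centroid K) u : ℝ) • (x - centroid K)) = _
  rw [← integral_inner]
  · simp only [inner_smul_right, real_inner_comm]
  · exact ContinuousOn.integrableOn_compact hK (by fun_prop)

lemma inertiaOp_self {n : ℕ} {K : Set (EuclideanSpace ℝ (Fin n))} (hK : IsCompact K)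
    (u : EuclideanSpace ℝ (Fin n)) : inner ℝ u (inertiaOp K hK u) = Iu K u := by
  rw [inertiaOp_inner, Iu, Jq]
  congr 1
  funext x
  rw [inner_sub_left, real_inner_comm x, real_inner_comm (centroid K)]
  ring

lemma Iu_sum {n : ℕ} {ι : Type*} {K : Set (EuclideanSpace ℝ (Fin n))} (hK : IsCompact K)
    (S : Finset ι) (w : ι → EuclideanSpace ℝ (Fin n)) (C : ℝ)
    (h : ∀ x, ∑ i ∈ S, (inner ℝ (w i) x) ^ 2 = C * ‖x‖ ^ 2) :
    ∑ i ∈ S, Iu K (w i) = C * inertia K := by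
  unfold Iu Jq inertia
  rw [← integral_finsetSum, ← integral_const_mul]
  · congr 1
    funext x
    rw [← h]
    simp only [inner_sub_right]
  · intro i _
    exact ContinuousOn.integrableOn_compact hK (by fun_prop)

lemma signs_sum_mul {n : ℕ} (i j : Fin n) :
    ∑ ε : Fin n → ℤˣ, ((ε i : ℤ) : ℝ) * ((ε j : ℤ) : ℝ) = if i = j then 2 ^ n else 0 := by
  split_ifs with h
  · subst h
    have : ∀ ε : Fin n → ℤˣ, ((ε i : ℤ) : ℝ) * ((ε i : ℤ) : ℝ) = 1 := by
      intro ε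
      rcases Int.units_eq_one_or (ε i) with h | h <;> simp [h]
    simp [this]
  · have e := Equiv.sum_comp (Equiv.mulLeft (Function.update (1 : Fin n → ℤˣ) i (-1)))
      (fun ε : Fin n → ℤˣ => ((ε i : ℤ) : ℝ) * ((ε j : ℤ) : ℝ))
    simp [Function.update_of_ne (Ne.symm h)] at e
    linarith

lemma sign_vec {n : ℕ} (b : OrthonormalBasis (Fin n) ℝ (EuclideanSpace ℝ (Fin n)))
    (x : EuclideanSpace ℝ (Fin n)) :
    ∑ ε : Fin n → ℤˣ, (inner ℝ (∑ i, ((ε i : ℤ) : ℝ) • b i) x) ^ 2 = 2 ^ n * ‖x‖ ^ 2 := by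
  have : ∀ ε : Fin n → ℤˣ, (inner ℝ (∑ i, ((ε i : ℤ) : ℝ) • b i) x) ^ 2
      = ∑ i, ∑ j, (((ε i : ℤ) : ℝ) * ((ε j : ℤ) : ℝ)) * (inner ℝ (b i) x * inner ℝ (b j) x) := by
    intro ε
    rw [sum_inner, sq, Finset.sum_mul_sum]
    refine Finset.sum_congr rfl fun i _ => Finset.sum_congr rfl fun j _ => ?_
    simp only [real_inner_smul_left]
    ring
  simp only [this]
  rw [Finset.sum_comm]
  have h2 : ∀ i, ∑ ε : Fin n → ℤˣ, ∑ j, (((ε i : ℤ) : ℝ) * ((ε j : ℤ) : ℝ)) *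
      (inner ℝ (b i) x * inner ℝ (b j) x) = 2 ^ n * (inner ℝ (b i) x) ^ 2 := by
    intro i
    rw [Finset.sum_comm]
    simp only [← Finset.sum_mul, signs_sum_mul]
    simp [sq]
  simp only [h2]
  rw [← Finset.mul_sum]
  congr 1
  have := b.sum_sq_norm_inner_right x
  simpa using this

lemma exists_frame {n : ℕ} {K L : Set (EuclideanSpace ℝ (Fin n))} (hK : IsCompact K)
    (hL : IsCompact L) : ∃ b : OrthonormalBasis (Fin n) ℝ (EuclideanSpace ℝ (Fin n)),
    ∀ ε : Fin n → ℤˣ, inertia L * Iu K (∑ i, ((ε i : ℤ) : ℝ) • b i)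
      = inertia K * Iu L (∑ i, ((ε i : ℤ) : ℝ) • b i) := by
  let D := inertia L • inertiaOp K hK - inertia K • inertiaOp L hL
  have Dq : ∀ u, inner ℝ u (D u) = inertia L * Iu K u - inertia K * Iu L u := by
    intro u
    simp only [D, LinearMap.sub_apply, LinearMap.smul_apply, inner_sub_right, inner_smul_right,
      inertiaOp_self]
  have hD : D.IsSymmetric := by
    intro u v
    rw [real_inner_comm]
    simp only [D, LinearMap.sub_apply, LinearMap.smul_apply, inner_sub_right, inner_smul_right,
      inertiaOp_inner]
    simp only [mul_comm]
  have hfr : Module.finrank ℝ (EuclideanSpace ℝ (Fin n)) = n := by simp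
  let b := hD.eigenvectorBasis hfr
  have hb : ∀ i, D (b i) = hD.eigenvalues hfr i • b i := fun i =>
    hD.apply_eigenvectorBasis hfr i
  have hdiag : ∀ i, inner ℝ (b i) (D (b i)) = hD.eigenvalues hfr i := by
    intro i
    rw [hb, inner_smul_right, real_inner_self_eq_norm_sq, b.norm_eq_one]; simp
  have hsumI : ∀ M : Set (EuclideanSpace ℝ (Fin n)), IsCompact M →
      ∑ i, Iu M (b i) = inertia M := by
    intro M hM
    rw [Iu_sum hM Finset.univ b 1, one_mul]
    intro x
    have := b.sum_sq_norm_inner_right x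
    simpa using this
  have htr : ∑ i, hD.eigenvalues hfr i = 0 := by
    simp only [← hdiag, Dq, Finset.sum_sub_distrib, ← Finset.mul_sum, hsumI K hK, hsumI L hL]
    ring
  refine ⟨b, fun ε => ?_⟩
  have : inner ℝ (∑ i, ((ε i : ℤ) : ℝ) • b i) (D (∑ i, ((ε i : ℤ) : ℝ) • b i)) = (0 : ℝ) := by
    simp only [map_sum, map_smul, hb, smul_smul]
    rw [b.orthonormal.inner_sum]
    rw [← htr]
    refine Finset.sum_congr rfl fun i _ => ?_
    rcases Int.units_eq_one_or (ε i) with h | h <;> simp [h]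
  rw [Dq] at this
  linarith

theorem inertia_brunn_minkowski {n : ℕ} (hn : 1 ≤ n)
    (K L : Set (EuclideanSpace ℝ (Fin n)))
    (hK : IsConvexBody K) (hL : IsConvexBody L) :
    inertia K ^ ((1 : ℝ) / (n + 2)) + inertia L ^ ((1 : ℝ) / (n + 2)) ≤
      inertia (K + L) ^ ((1 : ℝ) / (n + 2)) := by
  obtain ⟨b, hb⟩ := exists_frame hK.1 hL.1
  set w : (Fin n → ℤˣ) → EuclideanSpace ℝ (Fin n) := fun ε => ∑ i, ((ε i : ℤ) : ℝ) • b i with hw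
  have hw0 : ∀ ε, w ε ≠ 0 := by
    intro ε h0
    have h1 : inner ℝ (b ⟨0, hn⟩) (w ε) = ((ε ⟨0, hn⟩ : ℤ) : ℝ) :=
      b.orthonormal.inner_right_fintype _ _
    rw [h0, inner_zero_right] at h1
    rcases Int.units_eq_one_or (ε ⟨0, hn⟩) with h | h <;> simp [h] at h1
  have hS : ∀ M : Set (EuclideanSpace ℝ (Fin n)), IsCompact M →
      ∑ ε, Iu M (w ε) = 2 ^ n * inertia M := fun M hM =>
    Iu_sum hM Finset.univ w _ (sign_vec b)
  have hpos : ∀ M : Set (EuclideanSpace ℝ (Fin n)), IsConvexBody M → 0 < inertia M := by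
    intro M hM
    have h1 : 0 < ∑ ε, Iu M (w ε) := Finset.sum_pos (fun ε _ => Jq_pos hM (hw0 ε) _) ⟨1, by simp⟩
    rw [hS M hM.1] at h1
    exact pos_of_mul_pos_right h1 (by positivity)
  have pK := hpos K hK
  have pL := hpos L hL
  have pKL := hpos _ (body_add hK hL)
  set X := inertia K ^ ((1 : ℝ) / (n + 2)) + inertia L ^ ((1 : ℝ) / (n + 2)) with hX
  have hX0 : 0 ≤ X := add_nonneg (Real.rpow_nonneg pK.le _) (Real.rpow_nonneg pL.le _)
  have key : ∀ ε, Iu K (w ε) / inertia K * X ^ (n + 2) ≤ Iu (K + L) (w ε) := by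
    intro ε
    have hθ : 0 ≤ Iu K (w ε) / inertia K := div_nonneg (Jq_pos hK (hw0 ε) _).le pK.le
    rw [hX, ← rpow_scale hθ pK.le pL.le]
    refine le_trans (le_of_eq ?_) (Iu_bm hK hL (hw0 ε))
    have e1 : Iu K (w ε) / inertia K * inertia K = Iu K (w ε) := by field_simp
    have e2 : Iu K (w ε) / inertia K * inertia L = Iu L (w ε) := by
      have := hb ε
      field_simp
      linarith
    rw [e1, e2]
  have hsum := Finset.sum_le_sum fun ε (_ : ε ∈ (Finset.univ : Finset (Fin n → ℤˣ))) => key ε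
  rw [← Finset.sum_mul, ← Finset.sum_div, hS K hK.1, hS (K + L) (body_add hK hL).1,
    mul_div_cancel_right₀ _ pK.ne'] at hsum
  have hfin : X ^ (n + 2) ≤ inertia (K + L) := le_of_mul_le_mul_left hsum (by positivity)
  have := Real.rpow_le_rpow (by positivity) hfin (z := (1 : ℝ) / (n + 2)) (by positivity)
  refine le_trans (le_of_eq ?_) this
  rw [← Real.rpow_natCast, ← Real.rpow_mul hX0]
  push_cast
  rw [mul_one_div_cancel (by positivity), Real.rpow_one]
end
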